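/- Let η > 0 be a constant for which the bilinear estimate holds, 0 < ε < 1/(4η), and let û_∞ be the stationary solution with force F̂ (ess sup_ξ |F̂| < ε, ess sup_ξ |ξ|²|û_∞| ≤ 2ε). Let v̂₀ : ℝ³ → ℂ³ be measurable and Ĝ : ℝ³ × [0,∞) → ℂ³ jointly measurable with ess sup_ξ |ξ|²|v̂₀(ξ)| + sup_{t≥0} ess sup_ξ |Ĝ(ξ,t)| ≤ ε, and let v̂ be the corresponding Fourier-side mild solution with sup_t ess sup_ξ |ξ|²|v̂(·,t)| ≤ 2ε. If lim_{t→∞} ess sup_ξ |ξ|² e^{−t|ξ|²} |v̂₀(ξ) − û_∞(ξ)| = 0 and lim_{t→∞} ess sup_ξ |Ĝ(ξ,t) − F̂(ξ)| = 0, then lim_{t→∞} ess sup_ξ |ξ|² |v̂(ξ,t) − û_∞(ξ)| = 0. -/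

import Mathlib

open MeasureTheory Filter
open scoped ENNReal

noncomputable section

abbrev E3 : Type := EuclideanSpace ℝ (Fin 3)
abbrev V3 : Type := Fin 3 → ℂ

/-- The `PM^a` norm (on the Fourier side): `ess sup_ξ |ξ|^a |g(ξ)|`, valued in `ℝ≥0∞`. -/
def PMnorm (a : ℝ) (g : E3 → V3) : ℝ≥0∞ :=
  essSup (fun ξ : E3 => ENNReal.ofReal (‖ξ‖ ^ a * ‖g ξ‖)) volume

/-- The symbol `P̂(ξ)_{jk} = δ_{jk} − ξ_j ξ_k / |ξ|²` of the Leray projector. -/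
def LerayP (ξ : E3) : Matrix (Fin 3) (Fin 3) ℂ :=
  fun j k => (if j = k then (1 : ℂ) else 0) - ((ξ j : ℂ) * (ξ k : ℂ)) / ((‖ξ‖ : ℂ) ^ 2)

/-- The matrix-valued convolution
`Ŵ[v,w](ξ)_{jk} = (2π)^{-3/2} ∫ v_j(ξ−z) w_k(z) dz`
(the Fourier transform of the tensor product `v ⊗ w`). -/
def Wconv (v w : E3 → V3) (ξ : E3) : Matrix (Fin 3) (Fin 3) ℂ :=
  fun j k => (((2 * Real.pi) ^ ((3 : ℝ) / 2))⁻¹ : ℝ) • ∫ z : E3, v (ξ - z) j * w z k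

/-- The vector `iξ·Ŵ[v,w](ξ)`, with components `Σ_k iξ_k Ŵ[v,w](ξ)_{jk}`. -/
def ixW (v w : E3 → V3) (ξ : E3) : V3 :=
  fun j => ∑ k : Fin 3, Complex.I * (ξ k : ℂ) * Wconv v w ξ j k

/-- The Fourier side of the Navier–Stokes bilinear Duhamel term
`B(u,v)(t) = −∫₀ᵗ S(t−τ) P ∇·(u⊗v) dτ` (up to sign):
`∫₀ᵗ e^{−(t−τ)|ξ|²} P̂(ξ)( iξ·Ŵ[û(τ),v̂(τ)](ξ) ) dτ`. -/
def Bterm (u v : E3 → ℝ → V3) (ξ : E3) (t : ℝ) : V3 :=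
  ∫ τ in (0 : ℝ)..t, Real.exp (-(t - τ) * ‖ξ‖ ^ 2) •
    (LerayP ξ).mulVec (ixW (fun ζ => u ζ τ) (fun ζ => v ζ τ) ξ)

/-- The Fourier side of the Duhamel force term `∫₀ᵗ S(t−τ) P F(τ) dτ`. -/
def Fterm (F : E3 → ℝ → V3) (ξ : E3) (t : ℝ) : V3 :=
  ∫ τ in (0 : ℝ)..t, Real.exp (-(t - τ) * ‖ξ‖ ^ 2) • (LerayP ξ).mulVec (F ξ τ)

/-- `sup_{t ≥ 0} ‖u(t)‖_{PM^a}`. -/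
def supPM (a : ℝ) (u : E3 → ℝ → V3) : ℝ≥0∞ :=
  ⨆ (t : ℝ) (_ : 0 ≤ t), PMnorm a (fun ξ => u ξ t)

/-- A Fourier-side mild solution of the Navier–Stokes system with data `(û₀, F̂)`:
`û` is jointly measurable, all integrals converge absolutely, and for every `t ≥ 0`
and a.e. `ξ`,
`û(ξ,t) = e^{−t|ξ|²} û₀(ξ) − ∫₀ᵗ e^{−(t−τ)|ξ|²} P̂(ξ)(iξ·Ŵ[û(τ),û(τ)](ξ)) dτ
 + ∫₀ᵗ e^{−(t−τ)|ξ|²} P̂(ξ) F̂(ξ,τ) dτ`. -/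
def IsMildSolution (u0 : E3 → V3) (F : E3 → ℝ → V3) (u : E3 → ℝ → V3) : Prop :=
  Measurable (fun p : E3 × ℝ => u p.1 p.2) ∧
  ∀ t : ℝ, 0 ≤ t → ∀ᵐ ξ : E3,
    (∀ τ ∈ Set.Icc (0 : ℝ) t, ∀ j k : Fin 3,
        Integrable (fun z : E3 => u (ξ - z) τ j * u z τ k)) ∧
    IntervalIntegrable (fun τ : ℝ =>
        Real.exp (-(t - τ) * ‖ξ‖ ^ 2) •
          (LerayP ξ).mulVec (ixW (fun ζ => u ζ τ) (fun ζ => u ζ τ) ξ)) volume 0 t ∧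
    IntervalIntegrable (fun τ : ℝ =>
        Real.exp (-(t - τ) * ‖ξ‖ ^ 2) • (LerayP ξ).mulVec (F ξ τ)) volume 0 t ∧
    u ξ t = Real.exp (-t * ‖ξ‖ ^ 2) • u0 ξ - Bterm u u ξ t + Fterm F ξ t

/-- `η` is a constant for which the `PM²` bilinear estimate holds:
`‖B(u,v)(t)‖_{PM²} ≤ η (sup_τ ‖u(τ)‖_{PM²})(sup_τ ‖v(τ)‖_{PM²})`. -/
def BilinearEstimate (η : ℝ) : Prop :=
  ∀ u v : E3 → ℝ → V3,
    Measurable (fun p : E3 × ℝ => u p.1 p.2) →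
    Measurable (fun p : E3 × ℝ => v p.1 p.2) →
    ∀ t : ℝ, 0 ≤ t →
      PMnorm 2 (fun ξ => Bterm u v ξ t) ≤ ENNReal.ofReal η * supPM 2 u * supPM 2 v

/-- The Fourier side of the stationary Navier–Stokes integral equation
`u = −∫₀^∞ S(τ)P∇·(u⊗u)dτ + ∫₀^∞ S(τ)PF dτ`, i.e.
`û(ξ) = |ξ|^{−2}( −P̂(ξ)(iξ·Ŵ[û,û](ξ)) + P̂(ξ)F̂(ξ) )` for a.e. `ξ ≠ 0`. -/
def IsStationarySolution (F u : E3 → V3) : Prop :=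
  ∀ᵐ ξ : E3, ξ ≠ 0 →
    u ξ = ((‖ξ‖ : ℝ) ^ 2)⁻¹ •
      (-(LerayP ξ).mulVec (ixW u u ξ) + (LerayP ξ).mulVec (F ξ))

/-- `η` is a constant for which the stationary `PM²` bilinear estimate
`‖∫₀^∞ S(τ)P∇·(u⊗v)dτ‖_{PM²} ≤ η ‖u‖_{PM²} ‖v‖_{PM²}` holds on the Fourier side
(including absolute convergence of the convolutions). -/
def StationaryBilinearEstimate (η : ℝ) : Prop :=
  ∀ u v : E3 → V3, Measurable u → Measurable v →
    PMnorm 2 u ≠ ⊤ → PMnorm 2 v ≠ ⊤ →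
    (∀ᵐ ξ : E3, ∀ j k : Fin 3, Integrable (fun z : E3 => u (ξ - z) j * v z k)) ∧
    PMnorm 0 (fun ξ => (LerayP ξ).mulVec (ixW u v ξ)) ≤
      ENNReal.ofReal η * PMnorm 2 u * PMnorm 2 v

theorem PM_le_iff {a c : ℝ} (hc : 0 ≤ c) (g : E3 → V3) :
    PMnorm a g ≤ ENNReal.ofReal c ↔ ∀ᵐ ξ : E3, ‖ξ‖ ^ a * ‖g ξ‖ ≤ c := by
  unfold PMnorm
  constructor
  · intro h
    filter_upwards [ENNReal.ae_le_essSup (μ := (volume : Measure E3))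
      (fun ξ : E3 => ENNReal.ofReal (‖ξ‖ ^ a * ‖g ξ‖))] with ξ hξ
    exact (ENNReal.ofReal_le_ofReal_iff hc).1 (hξ.trans h)
  · intro h
    refine essSup_le_of_ae_le (ENNReal.ofReal c) ?_
    filter_upwards [h] with ξ hξ
    exact ENNReal.ofReal_le_ofReal hξ

theorem PM2_le_iff {c : ℝ} (hc : 0 ≤ c) (g : E3 → V3) :
    PMnorm 2 g ≤ ENNReal.ofReal c ↔ ∀ᵐ ξ : E3, ‖ξ‖ ^ 2 * ‖g ξ‖ ≤ c := by
  rw [PM_le_iff hc]; simp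

theorem PM0_le_iff {c : ℝ} (hc : 0 ≤ c) (g : E3 → V3) :
    PMnorm 0 g ≤ ENNReal.ofReal c ↔ ∀ᵐ ξ : E3, ‖g ξ‖ ≤ c := by
  rw [PM_le_iff hc]; simp

theorem ae_ne_zero3 : ∀ᵐ ξ : E3, ξ ≠ 0 := by
  rw [ae_iff]; simp

/-- The kernel dominating both local singularities and the tail. -/
def kern (r : ℝ) (x : E3) : ℝ := if ‖x‖ ≤ r then (‖x‖ ^ 2)⁻¹ else (‖x‖ ^ 4)⁻¹

theorem kern_integrable (r : ℝ) (hr : 0 < r) : Integrable (kern r) := by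
  have h := (integrable_fun_norm_addHaar (volume : Measure E3)
    (f := fun y : ℝ => if y ≤ r then (y ^ 2)⁻¹ else (y ^ 4)⁻¹)).2
  apply h
  have hd : Module.finrank ℝ E3 - 1 = 2 := by simp
  rw [hd]
  have : Set.Ioi (0:ℝ) = Set.Ioc 0 r ∪ Set.Ioi r := by
    rw [Set.Ioc_union_Ioi_eq_Ioi hr.le]
  rw [this]
  apply IntegrableOn.union
  · have h1 : IntegrableOn (fun _ : ℝ => (1:ℝ)) (Set.Ioc 0 r) := by simp
    refine h1.congr_fun ?_ measurableSet_Ioc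
    intro y hy
    have : y ≠ 0 := hy.1.ne'
    simp [hy.2]
    field_simp
  · have h1 := integrableOn_Ioi_rpow_of_lt (a := (-2:ℝ)) (by norm_num) hr
    refine h1.congr_fun ?_ measurableSet_Ioi
    intro y hy
    have hy' : r < y := hy
    have : y ≠ 0 := (hr.trans hy').ne'
    have h2 : y ^ (-2:ℝ) = (y^2)⁻¹ := by
      rw [Real.rpow_neg (hr.trans hy').le]; simp
    simp only [h2, not_le.2 hy', if_false, smul_eq_mul]
    field_simp

theorem kern_nonneg (r : ℝ) (x : E3) : 0 ≤ kern r x := by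
  unfold kern; split_ifs <;> positivity

theorem dom_bound (ξ z : E3) (hξ : ξ ≠ 0) :
    (‖ξ - z‖ ^ 2)⁻¹ * (‖z‖ ^ 2)⁻¹ ≤
      ((‖ξ‖ / 2) ^ 2)⁻¹ * (kern (‖ξ‖/2) (ξ - z) + kern (‖ξ‖/2) z)
      + (kern (‖ξ‖/2) (ξ - z) + kern (‖ξ‖/2) z) := by
  have hn : 0 < ‖ξ‖ := norm_pos_iff.2 hξ
  set r := ‖ξ‖ / 2 with hr
  have hrp : 0 < r := by positivity
  have htri : ‖ξ‖ ≤ ‖ξ - z‖ + ‖z‖ := by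
    simpa using norm_add_le (ξ - z) z
  have k1 := kern_nonneg r (ξ - z)
  have k2 := kern_nonneg r z
  have hc : 0 ≤ (r^2)⁻¹ := by positivity
  by_cases h1 : ‖z‖ ≤ r
  · have h3 : r ≤ ‖ξ - z‖ := by linarith
    have e : kern r z = (‖z‖^2)⁻¹ := by simp [kern, h1]
    have : (‖ξ - z‖ ^ 2)⁻¹ * (‖z‖ ^ 2)⁻¹ ≤ (r^2)⁻¹ * kern r z := by
      rw [e]; gcongr
    nlinarith [mul_nonneg hc k1]
  · by_cases h2 : ‖ξ - z‖ ≤ r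
    · have e : kern r (ξ - z) = (‖ξ - z‖^2)⁻¹ := by simp [kern, h2]
      have : (‖ξ - z‖ ^ 2)⁻¹ * (‖z‖ ^ 2)⁻¹ ≤ kern r (ξ - z) * (r^2)⁻¹ := by
        rw [e]; push Not at h1; gcongr
      nlinarith [mul_nonneg hc k2]
    · have e : kern r z = ((‖z‖^2)⁻¹)^2 := by simp [kern, h1]; ring
      have e' : kern r (ξ - z) = ((‖ξ - z‖^2)⁻¹)^2 := by simp [kern, h2]; ring
      have : (‖ξ - z‖ ^ 2)⁻¹ * (‖z‖ ^ 2)⁻¹ ≤ kern r (ξ - z) + kern r z := by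
        rw [e, e']; nlinarith [sq_nonneg ((‖ξ - z‖ ^ 2)⁻¹ - (‖z‖ ^ 2)⁻¹), sq_nonneg ((‖ξ - z‖ ^ 2)⁻¹ + (‖z‖ ^ 2)⁻¹)]
      nlinarith [mul_nonneg hc k2, mul_nonneg hc k1]

theorem conv_integrable {u v : E3 → V3} (hu : Measurable u) (hv : Measurable v) {a b : ℝ}
    (ha : 0 ≤ a) (hb : 0 ≤ b)
    (hua : PMnorm 2 u ≤ ENNReal.ofReal a) (hvb : PMnorm 2 v ≤ ENNReal.ofReal b)
    (ξ : E3) (hξ : ξ ≠ 0) (j k : Fin 3) :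
    Integrable (fun z : E3 => u (ξ - z) j * v z k) := by
  rw [PM2_le_iff ha] at hua
  rw [PM2_le_iff hb] at hvb
  have hr : 0 < ‖ξ‖ / 2 := by have := norm_pos_iff.2 hξ; positivity
  have i1 := kern_integrable (‖ξ‖/2) hr
  have i2 := i1.comp_sub_left ξ
  have i3 := (((i2.add i1).const_mul (((‖ξ‖ / 2) ^ 2)⁻¹)).add (i2.add i1)).const_mul (a * b)
  refine i3.mono' ?_ ?_
  · apply Measurable.aestronglyMeasurable
    fun_prop
  · have hua' := (quasiMeasurePreserving_sub_left (volume : Measure E3) ξ).ae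
      (hua.and ae_ne_zero3)
    filter_upwards [hua', hvb, ae_ne_zero3] with z h1 h2 h3
    obtain ⟨h1, h4⟩ := h1
    have p1 : 0 < ‖ξ - z‖ := norm_pos_iff.2 h4
    have p2 : 0 < ‖z‖ := norm_pos_iff.2 h3
    have q1 : ‖u (ξ - z) j‖ ≤ a * (‖ξ - z‖^2)⁻¹ := by
      refine (norm_le_pi_norm _ j).trans ?_
      rw [← div_eq_mul_inv, le_div_iff₀ (by positivity)]; linarith
    have q2 : ‖v z k‖ ≤ b * (‖z‖^2)⁻¹ := by
      refine (norm_le_pi_norm _ k).trans ?_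
      rw [← div_eq_mul_inv, le_div_iff₀ (by positivity)]; linarith
    rw [norm_mul]
    calc _ ≤ (a * (‖ξ - z‖^2)⁻¹) * (b * (‖z‖^2)⁻¹) := by gcongr
      _ = (a * b) * ((‖ξ - z‖ ^ 2)⁻¹ * (‖z‖ ^ 2)⁻¹) := by ring
      _ ≤ _ := by
        apply mul_le_mul_of_nonneg_left _ (by positivity)
        exact dom_bound ξ z hξ

/-- Linear splitting of the quadratic term. -/
theorem ixW_split {u v : E3 → V3} (ξ : E3)
    (h1 : ∀ j k : Fin 3, Integrable (fun z : E3 => (v - u) (ξ - z) j * v z k))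
    (h2 : ∀ j k : Fin 3, Integrable (fun z : E3 => u (ξ - z) j * (v - u) z k))
    (h3 : ∀ j k : Fin 3, Integrable (fun z : E3 => u (ξ - z) j * u z k)) :
    ixW v v ξ - ixW u u ξ = ixW (v - u) v ξ + ixW u (v - u) ξ := by
  have hW : ∀ j k, Wconv v v ξ j k = Wconv (v - u) v ξ j k + Wconv u (v - u) ξ j k
      + Wconv u u ξ j k := by
    intro j k
    unfold Wconv
    rw [← smul_add, ← smul_add, ← integral_add (h1 j k) (h2 j k),
      ← integral_add (f := fun z => (v - u) (ξ - z) j * v z k + u (ξ - z) j * (v - u) z k)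
        ((h1 j k).add (h2 j k)) (h3 j k)]
    congr 2
    funext z
    simp only [Pi.sub_apply]
    ring
  funext j
  simp only [ixW, Pi.sub_apply, Pi.add_apply, hW, ← Finset.sum_sub_distrib, ← Finset.sum_add_distrib]
  apply Finset.sum_congr rfl
  intro k _
  ring

theorem Leray_bound (ξ : E3) (x : V3) : ‖(LerayP ξ).mulVec x‖ ≤ 6 * ‖x‖ := by
  rw [pi_norm_le_iff_of_nonneg (by positivity)]
  intro j
  have hent : ∀ k, ‖LerayP ξ j k‖ ≤ 2 := by
    intro k
    unfold LerayP
    refine (norm_sub_le _ _).trans ?_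
    have h1 : ‖(if j = k then (1:ℂ) else 0)‖ ≤ 1 := by split_ifs <;> simp
    have h2 : ‖((ξ j : ℂ) * (ξ k : ℂ)) / ((‖ξ‖ : ℂ) ^ 2)‖ ≤ 1 := by
      rw [norm_div, norm_mul, norm_pow]
      simp only [Complex.norm_real, norm_norm]
      apply div_le_one_of_le₀ _ (by positivity)
      rw [sq]
      exact mul_le_mul (PiLp.norm_apply_le ξ j) (PiLp.norm_apply_le ξ k) (norm_nonneg _) (norm_nonneg _)
    linarith
  unfold Matrix.mulVec dotProduct
  refine (norm_sum_le _ _).trans ?_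
  calc ∑ k, ‖LerayP ξ j k * x k‖ ≤ ∑ k : Fin 3, 2 * ‖x‖ := by
        apply Finset.sum_le_sum
        intro k _
        rw [norm_mul]
        exact mul_le_mul (hent k) (norm_le_pi_norm x k) (norm_nonneg _) (by norm_num)
    _ = 6 * ‖x‖ := by simp; ring

theorem exp_int (x s t : ℝ) (hx : x ≠ 0) :
    ∫ τ in s..t, Real.exp (-(t - τ) * x) = (1 - Real.exp (-(t - s) * x)) / x := by
  have : ∀ τ ∈ Set.uIcc s t, HasDerivAt (fun τ => Real.exp (-(t - τ) * x) / x)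
      (Real.exp (-(t - τ) * x)) τ := by
    intro τ _
    have h1 : HasDerivAt (fun τ => -(t - τ) * x) x τ := by
      have := (((hasDerivAt_id τ).const_sub t).neg).mul_const x
      simpa using this
    have := (h1.exp).div_const x
    rw [mul_div_cancel_right₀ _ hx] at this
    exact this
  rw [intervalIntegral.integral_eq_sub_of_hasDerivAt this
    (Continuous.intervalIntegrable (by fun_prop) _ _)]
  simp
  ring

/-- The stationary bilinear estimate follows from the evolutionary one. -/
theorem stat_bound {η : ℝ} (hη : 0 < η) (hB : BilinearEstimate η) {u v : E3 → V3}
    (hu : Measurable u) (hv : Measurable v) {a b : ℝ} (ha : 0 ≤ a) (hb : 0 ≤ b)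
    (hua : PMnorm 2 u ≤ ENNReal.ofReal a) (hvb : PMnorm 2 v ≤ ENNReal.ofReal b) :
    ∀ᵐ ξ : E3, ‖(LerayP ξ).mulVec (ixW u v ξ)‖ ≤ η * a * b := by
  have key : ∀ n : ℕ, ∀ᵐ ξ : E3,
      ‖ξ‖ ^ 2 * ‖Bterm (fun ξ _ => u ξ) (fun ξ _ => v ξ) ξ n‖ ≤ η * a * b := by
    intro n
    rw [← PM2_le_iff (by positivity)]
    refine (hB (fun ξ _ => u ξ) (fun ξ _ => v ξ) (hu.comp measurable_fst)
      (hv.comp measurable_fst) n (by positivity)).trans ?_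
    rw [ENNReal.ofReal_mul (by positivity), ENNReal.ofReal_mul (by positivity)]
    gcongr
    · exact iSup₂_le fun _ _ => hua
    · exact iSup₂_le fun _ _ => hvb
  filter_upwards [ae_all_iff.2 key, ae_ne_zero3] with ξ hξ h0
  have hp : 0 < ‖ξ‖ ^ 2 := by have := norm_pos_iff.2 h0; positivity
  set M := (LerayP ξ).mulVec (ixW u v ξ) with hM
  have h2 : ∀ n : ℕ, (1 - Real.exp (-(n:ℝ) * ‖ξ‖^2)) * ‖M‖ ≤ η * a * b := by
    intro n
    have := hξ n
    unfold Bterm at this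
    rw [intervalIntegral.integral_smul_const, exp_int _ _ _ hp.ne', norm_smul, sub_zero] at this
    have hle : Real.exp (-(n:ℝ) * ‖ξ‖^2) ≤ 1 := by
      apply Real.exp_le_one_iff.2
      have : (0:ℝ) ≤ n * ‖ξ‖^2 := by positivity
      linarith
    rw [Real.norm_of_nonneg (div_nonneg (by linarith) hp.le), ← mul_assoc,
      mul_div_cancel₀ _ hp.ne'] at this
    exact this
  have hlim : Tendsto (fun n : ℕ => (1 - Real.exp (-(n:ℝ) * ‖ξ‖^2)) * ‖M‖) atTop
      (nhds ((1 - 0) * ‖M‖)) := by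
    apply Tendsto.mul_const
    apply Tendsto.const_sub
    apply Real.tendsto_exp_atBot.comp
    have := (tendsto_natCast_atTop_atTop (R := ℝ)).atTop_mul_const hp
    refine (tendsto_neg_atTop_atBot.comp this).congr ?_
    intro n
    simp [neg_mul]
  have := le_of_tendsto' hlim h2
  simpa using this

theorem x_exp_le {s : ℝ} (hs : 0 < s) (x : ℝ) : x * Real.exp (-s * x) ≤ 1 / s := by
  rw [le_div_iff₀ hs]
  have h := Real.add_one_le_exp (s * x)
  have h2 : Real.exp (s * x) * Real.exp (-s * x) = 1 := by
    rw [← Real.exp_add]; simp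
  have h3 := Real.exp_pos (-s * x)
  nlinarith

theorem duhamel_bound {x T t C c : ℝ} (hx : 0 < x) (hT : 0 ≤ T) (hTt : T < t) (hc : 0 ≤ c)
    (hC : 0 ≤ C) (N : ℝ → V3)
    (hi : IntervalIntegrable (fun τ => Real.exp (-(t - τ) * x) • N τ) volume 0 t)
    (hN : ∀ᵐ τ : ℝ, 0 ≤ τ → ‖N τ‖ ≤ C ∧ (T ≤ τ → ‖N τ‖ ≤ c)) :
    x * ‖∫ τ in (0:ℝ)..t, Real.exp (-(t - τ) * x) • N τ‖ ≤ T * C / (t - T) + c := by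
  have i1 : IntervalIntegrable (fun τ => Real.exp (-(t - τ) * x) • N τ) volume 0 T := by
    apply hi.mono_set
    rw [Set.uIcc_of_le hT, Set.uIcc_of_le (hT.trans hTt.le)]
    exact Set.Icc_subset_Icc_right hTt.le
  have i2 : IntervalIntegrable (fun τ => Real.exp (-(t - τ) * x) • N τ) volume T t := by
    apply hi.mono_set
    rw [Set.uIcc_of_le hTt.le, Set.uIcc_of_le (hT.trans hTt.le)]
    exact Set.Icc_subset_Icc_left hT
  rw [← intervalIntegral.integral_add_adjacent_intervals i1 i2]
  have b1 : ‖∫ τ in (0:ℝ)..T, Real.exp (-(t - τ) * x) • N τ‖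
      ≤ (Real.exp (-(t - T) * x) * C) * |T - 0| := by
    apply intervalIntegral.norm_integral_le_of_norm_le_const_ae
    filter_upwards [hN] with τ h hτ
    rw [Set.uIoc_of_le hT] at hτ
    rw [norm_smul, Real.norm_of_nonneg (Real.exp_pos _).le]
    apply mul_le_mul _ (h hτ.1.le).1 (norm_nonneg _) (Real.exp_pos _).le
    apply Real.exp_le_exp.2
    have := hτ.2
    nlinarith
  have b2 : ‖∫ τ in T..t, Real.exp (-(t - τ) * x) • N τ‖
      ≤ ∫ τ in T..t, Real.exp (-(t - τ) * x) * c := by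
    apply intervalIntegral.norm_integral_le_of_norm_le hTt.le
    · filter_upwards [hN] with τ h hτ
      rw [norm_smul, Real.norm_of_nonneg (Real.exp_pos _).le]
      exact mul_le_mul_of_nonneg_left ((h (hT.trans hτ.1.le)).2 hτ.1.le) (Real.exp_pos _).le
    · exact Continuous.intervalIntegrable (by fun_prop) _ _
  rw [intervalIntegral.integral_mul_const, exp_int _ _ _ hx.ne'] at b2
  rw [sub_zero, abs_of_nonneg hT] at b1
  have b3 : x * ((1 - Real.exp (-(t - T) * x)) / x * c) ≤ c := by
    rw [← mul_assoc, mul_div_cancel₀ _ hx.ne']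
    nlinarith [Real.exp_pos (-(t - T) * x)]
  have b4 := x_exp_le (sub_pos.2 hTt) x
  have b5 : x * ((Real.exp (-(t - T) * x) * C) * T) ≤ T * C / (t - T) := by
    calc _ = (T * C) * (x * Real.exp (-(t - T) * x)) := by ring
      _ ≤ (T * C) * (1 / (t - T)) := by gcongr
      _ = _ := by ring
  calc _ ≤ x * (‖∫ τ in (0:ℝ)..T, Real.exp (-(t - τ) * x) • N τ‖ +
        ‖∫ τ in T..t, Real.exp (-(t - τ) * x) • N τ‖) := by
        gcongr; exact norm_add_le _ _
    _ ≤ x * ((Real.exp (-(t - T) * x) * C) * T + (1 - Real.exp (-(t - T) * x)) / x * c) := by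
        gcongr
    _ ≤ _ := by rw [mul_add]; linarith

theorem measurable_Leray_mulVec {α : Type*} [MeasurableSpace α] {f : α → E3} {g : α → V3}
    (hf : Measurable f) (hg : Measurable g) :
    Measurable (fun p => (LerayP (f p)).mulVec (g p)) := by
  rw [measurable_pi_iff]
  intro j
  simp only [Matrix.mulVec, dotProduct, LerayP]
  fun_prop

theorem measurable_quad {v : E3 → ℝ → V3} (hv : Measurable (fun p : E3 × ℝ => v p.1 p.2)) :
    Measurable (fun p : E3 × ℝ =>
      (LerayP p.1).mulVec (ixW (fun ζ => v ζ p.2) (fun ζ => v ζ p.2) p.1)) := by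
  apply measurable_Leray_mulVec measurable_fst
  rw [measurable_pi_iff]
  intro j
  have hW : ∀ k, Measurable (fun p : E3 × ℝ =>
      Wconv (fun ζ => v ζ p.2) (fun ζ => v ζ p.2) p.1 j k) := by
    intro k
    unfold Wconv
    have h1 : Measurable (fun q : (E3 × ℝ) × E3 =>
        v (q.1.1 - q.2) q.1.2 j * v q.2 q.1.2 k) := by
      have a1 : Measurable (fun q : (E3 × ℝ) × E3 => v (q.1.1 - q.2) q.1.2) :=
        hv.comp (f := fun q : (E3 × ℝ) × E3 => (q.1.1 - q.2, q.1.2)) (by fun_prop)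
      have a2 : Measurable (fun q : (E3 × ℝ) × E3 => v q.2 q.1.2) :=
        hv.comp (f := fun q : (E3 × ℝ) × E3 => (q.2, q.1.2)) (by fun_prop)
      exact ((measurable_pi_apply j).comp a1).mul ((measurable_pi_apply k).comp a2)
    exact (h1.stronglyMeasurable.integral_prod_right' (ν := volume)).measurable.const_smul
      (((2 * Real.pi) ^ ((3 : ℝ) / 2))⁻¹ : ℝ)
  simp only [ixW]
  fun_prop

/-- For a fixed time, the difference of the quadratic terms is controlled. -/
theorem quad_diff {η : ℝ} (hη : 0 < η) (hB : BilinearEstimate η) {u v : E3 → V3}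
    (hu : Measurable u) (hv : Measurable v) {a h : ℝ} (ha : 0 ≤ a) (hh : 0 ≤ h)
    (hua : PMnorm 2 u ≤ ENNReal.ofReal a) (hva : PMnorm 2 v ≤ ENNReal.ofReal a)
    (hw : PMnorm 2 (v - u) ≤ ENNReal.ofReal h) :
    ∀ᵐ ξ : E3, ‖(LerayP ξ).mulVec (ixW v v ξ) - (LerayP ξ).mulVec (ixW u u ξ)‖
      ≤ 2 * η * a * h := by
  have hwm : Measurable (v - u) := hv.sub hu
  filter_upwards [ae_ne_zero3, stat_bound hη hB hwm hv hh ha hw hva,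
    stat_bound hη hB hu hwm ha hh hua hw] with ξ h0 h1 h2
  rw [← Matrix.mulVec_sub, ixW_split ξ (conv_integrable hwm hv hh ha hw hva ξ h0)
    (conv_integrable hu hwm ha hh hua hw ξ h0) (conv_integrable hu hu ha ha hua hua ξ h0),
    Matrix.mulVec_add]
  refine (norm_add_le _ _).trans ?_
  linarith

/-- Full integrand of the difference equation. -/
def Nterm (F uinf : E3 → V3) (G v : E3 → ℝ → V3) (ξ : E3) (τ : ℝ) : V3 :=
  -((LerayP ξ).mulVec (ixW (fun ζ => v ζ τ) (fun ζ => v ζ τ) ξ)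
    - (LerayP ξ).mulVec (ixW uinf uinf ξ)) + (LerayP ξ).mulVec (G ξ τ - F ξ)

theorem diff_eq (F uinf : E3 → V3) (v0 : E3 → V3) (G v : E3 → ℝ → V3)
    (hstat : IsStationarySolution F uinf) (hv : IsMildSolution v0 G v) (t : ℝ) (ht : 0 ≤ t) :
    ∀ᵐ ξ : E3, IntervalIntegrable
        (fun τ => Real.exp (-(t - τ) * ‖ξ‖ ^ 2) • Nterm F uinf G v ξ τ) volume 0 t ∧
      v ξ t - uinf ξ = Real.exp (-t * ‖ξ‖ ^ 2) • (v0 ξ - uinf ξ)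
        + ∫ τ in (0:ℝ)..t, Real.exp (-(t - τ) * ‖ξ‖ ^ 2) • Nterm F uinf G v ξ τ := by
  filter_upwards [ae_ne_zero3, hstat, hv.2 t ht] with ξ h0 hs hm
  obtain ⟨-, i1, i2, he⟩ := hm
  have hs := hs h0
  have hp : 0 < ‖ξ‖ ^ 2 := by have := norm_pos_iff.2 h0; positivity
  have i3 : IntervalIntegrable (fun τ => Real.exp (-(t - τ) * ‖ξ‖ ^ 2) •
      (‖ξ‖ ^ 2 • uinf ξ)) volume 0 t :=
    Continuous.intervalIntegrable (by fun_prop) _ _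
  have hs' : ‖ξ‖ ^ 2 • uinf ξ =
      -(LerayP ξ).mulVec (ixW uinf uinf ξ) + (LerayP ξ).mulVec (F ξ) := by
    rw [hs, smul_smul, mul_inv_cancel₀ hp.ne', one_smul]
  have hN : (fun τ => Real.exp (-(t - τ) * ‖ξ‖ ^ 2) • Nterm F uinf G v ξ τ) =
      fun τ => (Real.exp (-(t - τ) * ‖ξ‖ ^ 2) • (LerayP ξ).mulVec (G ξ τ)
        - Real.exp (-(t - τ) * ‖ξ‖ ^ 2) •
          (LerayP ξ).mulVec (ixW (fun ζ => v ζ τ) (fun ζ => v ζ τ) ξ))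
        - Real.exp (-(t - τ) * ‖ξ‖ ^ 2) • (‖ξ‖ ^ 2 • uinf ξ) := by
    funext τ
    rw [hs', Nterm, Matrix.mulVec_sub, ← smul_sub, ← smul_sub]
    congr 1
    abel
  rw [hN]
  refine ⟨(i2.sub i1).sub i3, ?_⟩
  rw [intervalIntegral.integral_sub (i2.sub i1) i3, intervalIntegral.integral_sub i2 i1,
    intervalIntegral.integral_smul_const, exp_int _ _ _ hp.ne', smul_smul,
    div_mul_cancel₀ _ hp.ne', he, sub_zero]
  unfold Bterm Fterm
  rw [smul_sub, sub_smul, one_smul]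
  abel

/-- One step of the limsup contraction. -/
theorem contraction_step (η ε : ℝ) (hη : 0 < η)
    (hB : BilinearEstimate η) (hε : 0 < ε)
    (F uinf : E3 → V3) (hFm : Measurable F) (huinfm : Measurable uinf)
    (hF : PMnorm 0 F ≤ ENNReal.ofReal ε)
    (hstat : IsStationarySolution F uinf)
    (huinfb : PMnorm 2 uinf ≤ ENNReal.ofReal (2 * ε))
    (v0 : E3 → V3) (G : E3 → ℝ → V3) (v : E3 → ℝ → V3)
    (hGm : Measurable (fun p : E3 × ℝ => G p.1 p.2))
    (hG : ∀ t : ℝ, 0 ≤ t → PMnorm 0 (fun ξ => G ξ t) ≤ ENNReal.ofReal ε)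
    (hv : IsMildSolution v0 G v)
    (hvb : ∀ t : ℝ, 0 ≤ t → PMnorm 2 (fun ξ => v ξ t) ≤ ENNReal.ofReal (2 * ε))
    (hini : Tendsto (fun t : ℝ =>
        PMnorm 2 (fun ξ => Real.exp (-t * ‖ξ‖ ^ 2) • (v0 ξ - uinf ξ))) atTop (nhds 0))
    (hforce : Tendsto (fun t : ℝ =>
        PMnorm 0 (fun ξ => G ξ t - F ξ)) atTop (nhds 0))
    (hw4 : ∀ t : ℝ, 0 ≤ t → PMnorm 2 (fun ξ => v ξ t - uinf ξ) ≤ ENNReal.ofReal (4 * ε))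
    (K δ : ℝ) (hK : 0 ≤ K) (hδ : 0 < δ)
    (hKe : ∀ᶠ t : ℝ in atTop, PMnorm 2 (fun ξ => v ξ t - uinf ξ) ≤ ENNReal.ofReal K) :
    ∀ᶠ t : ℝ in atTop, PMnorm 2 (fun ξ => v ξ t - uinf ξ)
      ≤ ENNReal.ofReal (4 * η * ε * K + δ) := by
  have hforce' : ∀ᶠ t : ℝ in atTop, PMnorm 0 (fun ξ => G ξ t - F ξ) ≤ ENNReal.ofReal (δ / 12) :=
    hforce.eventually_le_const (by simpa using by positivity)
  have hini' : ∀ᶠ t : ℝ in atTop,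
      PMnorm 2 (fun ξ => Real.exp (-t * ‖ξ‖ ^ 2) • (v0 ξ - uinf ξ)) ≤ ENNReal.ofReal (δ / 4) :=
    hini.eventually_le_const (by simpa using by positivity)
  obtain ⟨T0, hT0⟩ := eventually_atTop.1 (hforce'.and hKe)
  set T := max T0 0 with hTdef
  have hT : 0 ≤ T := le_max_right _ _
  set C : ℝ := 2 * η * (2 * ε) * (4 * ε) + 6 * (2 * ε) with hCdef
  have hC : 0 ≤ C := by positivity
  set c : ℝ := 4 * η * ε * K + δ / 2 with hcdef
  have hc : 0 ≤ c := by positivity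
  have hGF : ∀ t : ℝ, 0 ≤ t → ∀ᵐ ξ : E3, ‖G ξ t - F ξ‖ ≤ 2 * ε := by
    intro t ht
    filter_upwards [(PM0_le_iff hε.le _).1 (hG t ht), (PM0_le_iff hε.le _).1 hF] with ξ h1 h2
    refine (norm_sub_le _ _).trans ?_
    linarith
  have hvm : ∀ t, Measurable (fun ξ => v ξ t) := fun t =>
    hv.1.comp (f := fun ξ : E3 => (ξ, t)) (by fun_prop)
  have hNm : Measurable (fun p : E3 × ℝ => Nterm F uinf G v p.1 p.2) := by
    unfold Nterm
    have m1 := measurable_quad hv.1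
    have m2 : Measurable (fun p : E3 × ℝ => (LerayP p.1).mulVec (ixW uinf uinf p.1)) :=
      measurable_quad (v := fun ξ _ => uinf ξ) (huinfm.comp measurable_fst)
    have m3 : Measurable (fun p : E3 × ℝ => (LerayP p.1).mulVec (G p.1 p.2 - F p.1)) :=
      measurable_Leray_mulVec measurable_fst (hGm.sub (hFm.comp measurable_fst))
    exact ((m1.sub m2).neg).add m3
  have hae : ∀ᵐ ξ : E3, ∀ᵐ τ : ℝ, 0 ≤ τ → ‖Nterm F uinf G v ξ τ‖ ≤ C ∧
      (T ≤ τ → ‖Nterm F uinf G v ξ τ‖ ≤ c) := by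
    rw [Measure.ae_ae_comm]
    · refine ae_of_all _ fun τ => ?_
      by_cases hτ : 0 ≤ τ
      · have n1 : ∀ᵐ ξ : E3, ‖Nterm F uinf G v ξ τ‖ ≤ C := by
          filter_upwards [hGF τ hτ, quad_diff hη hB huinfm (hvm τ) (by positivity)
            (by positivity) huinfb (hvb τ hτ) (hw4 τ hτ)] with ξ h1 h2
          unfold Nterm
          refine (norm_add_le _ _).trans ?_
          rw [norm_neg]
          have := Leray_bound ξ (G ξ τ - F ξ)
          linarith
        by_cases hTτ : T ≤ τ
        · have hb := hT0 τ ((le_max_left _ _).trans hTτ)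
          have n2 : ∀ᵐ ξ : E3, ‖Nterm F uinf G v ξ τ‖ ≤ c := by
            filter_upwards [(PM0_le_iff (by positivity) _).1 hb.1,
              quad_diff hη hB huinfm (hvm τ) (by positivity)
              hK huinfb (hvb τ hτ) hb.2] with ξ h1 h2
            unfold Nterm
            refine (norm_add_le _ _).trans ?_
            rw [norm_neg]
            have := Leray_bound ξ (G ξ τ - F ξ)
            linarith
          filter_upwards [n1, n2] with ξ h1 h2 _
          exact ⟨h1, fun _ => h2⟩
        · filter_upwards [n1] with ξ h1 _
          exact ⟨h1, fun h => absurd h hTτ⟩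
      · exact ae_of_all _ fun ξ h => absurd h hτ
    · have hNn := hNm.norm
      have s0 : MeasurableSet {p : E3 × ℝ | 0 ≤ p.2} :=
        measurableSet_le measurable_const measurable_snd
      have s1 : MeasurableSet {p : E3 × ℝ | T ≤ p.2} :=
        measurableSet_le measurable_const measurable_snd
      have s2 : MeasurableSet {p : E3 × ℝ | ‖Nterm F uinf G v p.1 p.2‖ ≤ C} :=
        measurableSet_le hNn measurable_const
      have s3 : MeasurableSet {p : E3 × ℝ | ‖Nterm F uinf G v p.1 p.2‖ ≤ c} :=
        measurableSet_le hNn measurable_const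
      exact s0.imp (s2.inter (s1.imp s3))
  have hlim : Tendsto (fun t : ℝ => T * C / (t - T)) atTop (nhds 0) :=
    Tendsto.const_div_atTop (tendsto_atTop_add_const_right atTop (-T) tendsto_id) _
  have hlim' : ∀ᶠ t : ℝ in atTop, T * C / (t - T) ≤ δ / 4 :=
    hlim.eventually_le_const (by positivity)
  filter_upwards [hini', hlim', eventually_gt_atTop T] with t h1 h2 h3
  rw [PM2_le_iff (by positivity)]
  rw [PM2_le_iff (by positivity)] at h1
  filter_upwards [h1, hae, ae_ne_zero3, diff_eq F uinf v0 G v hstat hv t (hT.trans h3.le)]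
    with ξ g1 g2 g3 g4
  have hp : 0 < ‖ξ‖ ^ 2 := by have := norm_pos_iff.2 g3; positivity
  have g5 := duhamel_bound hp hT h3 hc hC _ g4.1 g2
  rw [g4.2]
  refine (mul_le_mul_of_nonneg_left (norm_add_le _ _) hp.le).trans ?_
  rw [mul_add]
  linarith

/-- **Asymptotic stability of small stationary solutions:** if `û_∞` is the small
stationary solution with force `F̂`, and `v̂` is a small mild solution with data
`(v̂₀, Ĝ)` such that `‖S(t)(v₀−u_∞)‖_{PM²} → 0` and `‖G(t)−F‖_{PM} → 0` as
`t → ∞`, then `‖v(t)−u_∞‖_{PM²} → 0` as `t → ∞`. -/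
theorem stationary_asymptotic_stability (η ε : ℝ) (hη : 0 < η)
    (hB : BilinearEstimate η) (hε : 0 < ε) (hε' : ε < 1 / (4 * η))
    (F uinf : E3 → V3) (hFm : Measurable F) (huinfm : Measurable uinf)
    (hF : PMnorm 0 F < ENNReal.ofReal ε)
    (hstat : IsStationarySolution F uinf)
    (huinfb : PMnorm 2 uinf ≤ ENNReal.ofReal (2 * ε))
    (v0 : E3 → V3) (G : E3 → ℝ → V3) (v : E3 → ℝ → V3)
    (hv0m : Measurable v0) (hGm : Measurable (fun p : E3 × ℝ => G p.1 p.2))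
    (hsmall : PMnorm 2 v0 + supPM 0 G ≤ ENNReal.ofReal ε)
    (hv : IsMildSolution v0 G v) (hvb : supPM 2 v ≤ ENNReal.ofReal (2 * ε))
    (hini : Tendsto (fun t : ℝ =>
        PMnorm 2 (fun ξ => Real.exp (-t * ‖ξ‖ ^ 2) • (v0 ξ - uinf ξ))) atTop (nhds 0))
    (hforce : Tendsto (fun t : ℝ =>
        PMnorm 0 (fun ξ => G ξ t - F ξ)) atTop (nhds 0)) :
    Tendsto (fun t : ℝ => PMnorm 2 (fun ξ => v ξ t - uinf ξ)) atTop (nhds 0) := by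
  have hG : ∀ t : ℝ, 0 ≤ t → PMnorm 0 (fun ξ => G ξ t) ≤ ENNReal.ofReal ε := by
    intro t ht
    have h1 : PMnorm 0 (fun ξ => G ξ t) ≤ supPM 0 G :=
      le_iSup₂ (f := fun (t : ℝ) (_ : 0 ≤ t) => PMnorm 0 (fun ξ => G ξ t)) t ht
    exact h1.trans (le_add_self.trans hsmall)
  have hvb' : ∀ t : ℝ, 0 ≤ t → PMnorm 2 (fun ξ => v ξ t) ≤ ENNReal.ofReal (2 * ε) := by
    intro t ht
    have h1 : PMnorm 2 (fun ξ => v ξ t) ≤ supPM 2 v :=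
      le_iSup₂ (f := fun (t : ℝ) (_ : 0 ≤ t) => PMnorm 2 (fun ξ => v ξ t)) t ht
    exact h1.trans hvb
  have hw4 : ∀ t : ℝ, 0 ≤ t →
      PMnorm 2 (fun ξ => v ξ t - uinf ξ) ≤ ENNReal.ofReal (4 * ε) := by
    intro t ht
    rw [PM2_le_iff (by positivity)]
    filter_upwards [(PM2_le_iff (by positivity) _).1 (hvb' t ht),
      (PM2_le_iff (by positivity) _).1 huinfb] with ξ h1 h2
    refine (mul_le_mul_of_nonneg_left (norm_sub_le _ _) (by positivity)).trans ?_
    rw [mul_add]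
    linarith
  have step := contraction_step η ε hη hB hε F uinf hFm huinfm hF.le hstat huinfb v0 G v hGm hG
    hv hvb' hini hforce hw4
  set q : ℝ := 4 * η * ε with hq
  have hq0 : 0 < q := by positivity
  have hq1 : q < 1 := by
    rw [lt_div_iff₀ (by positivity)] at hε'
    linarith
  let S : Set ℝ := {K : ℝ | 0 ≤ K ∧
    ∀ᶠ t : ℝ in atTop, PMnorm 2 (fun ξ => v ξ t - uinf ξ) ≤ ENNReal.ofReal K}
  have hSne : S.Nonempty := ⟨4 * ε, by positivity, by
    filter_upwards [eventually_ge_atTop 0] with t ht using hw4 t ht⟩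
  have hSb : BddBelow S := ⟨0, fun K hK => hK.1⟩
  have hL0 : 0 ≤ sInf S := le_csInf hSne fun K hK => hK.1
  have hL : sInf S = 0 := by
    by_contra hne
    have hpos : 0 < sInf S := lt_of_le_of_ne hL0 (Ne.symm hne)
    have hd : 0 < (1 - q) * sInf S / 4 := by
      have : 0 < 1 - q := by linarith
      positivity
    obtain ⟨K, hK, hKlt⟩ := exists_lt_of_csInf_lt hSne
      (show sInf S < sInf S + (1 - q) * sInf S / 4 by linarith)
    have h1 := step K _ hK.1 hd hK.2
    have h2 : sInf S ≤ q * K + (1 - q) * sInf S / 4 :=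
      csInf_le hSb ⟨by have := hK.1; positivity, h1⟩
    nlinarith
  rw [ENNReal.tendsto_nhds_zero]
  intro e he
  by_cases hetop : e = ⊤
  · exact Eventually.of_forall fun t => by simp [hetop]
  have her : 0 < e.toReal := ENNReal.toReal_pos he.ne' hetop
  obtain ⟨K, hK, hKlt⟩ := exists_lt_of_csInf_lt hSne (hL.trans_lt her)
  filter_upwards [hK.2] with t ht
  refine ht.trans ?_
  rw [← ENNReal.ofReal_toReal hetop]
  exact ENNReal.ofReal_le_ofReal hKlt.le
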